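/- arXiv:2604.03530 — 2 statements merged into one kernel-verified Lean document; each statement's English description precedes it below -/
import Mathlib

section
/- Let K ⊂ (-1,0) be a compact set. Then there exists an integer N₀ such that for all n ≥ N₀ and all q ∈ K one has S_n(q) ≠ 0, and moreover sup_{q ∈ K} |2 q^{n-2} ŷ_n(q) - 1| → 0 as n → ∞ (the supremum taken over n ≥ N₀). -/
open SimpleGraph Finset

noncomputable section

/-- The finset of edges of a simple graph on a finite vertex type. -/
def edgeFin {V : Type} [Finite V] (G : SimpleGraph V) : Finset (Sym2 V) :=
  (Set.toFinite G.edgeSet).toFinset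

open Classical in
/-- All-terminal reliability polynomial: `relPoly G q` is the probability that the graph stays
connected when every edge fails independently with probability `q`. -/
def relPoly {V : Type} [Finite V] (G : SimpleGraph V) (q : ℝ) : ℝ :=
  ∑ A ∈ (edgeFin G).powerset,
    if (SimpleGraph.fromEdgeSet (A : Set (Sym2 V))).Connected then
      (1 - q) ^ A.card * q ^ ((edgeFin G).card - A.card) else 0

open Classical in
/-- Split reliability polynomial with terminals `u`, `v`: the sum is over edge subsets whose
spanning subgraph has exactly two components, one containing `u` and the other containing `v`. -/
def splitRel {V : Type} [Finite V] (H : SimpleGraph V) (u v : V) (q : ℝ) : ℝ :=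
  ∑ A ∈ (edgeFin H).powerset,
    if (¬ (SimpleGraph.fromEdgeSet (A : Set (Sym2 V))).Reachable u v ∧
        ∀ w, (SimpleGraph.fromEdgeSet (A : Set (Sym2 V))).Reachable u w ∨
             (SimpleGraph.fromEdgeSet (A : Set (Sym2 V))).Reachable v w) then
      (1 - q) ^ A.card * q ^ ((edgeFin H).card - A.card) else 0

/-- The virtual edge interaction `ŷ_H = Rel(H)/S(H) + 1`. -/
def yhat {V : Type} [Finite V] (H : SimpleGraph V) (u v : V) (q : ℝ) : ℝ :=
  relPoly H q / splitRel H u v q + 1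

/-- `Hgraph n` is the complete graph on `Fin n` with the edge between `0` and `1` removed
(for `n ≥ 2`; for `n < 2` no edge is removed). -/
def Hgraph (n : ℕ) : SimpleGraph (Fin n) :=
  (⊤ : SimpleGraph (Fin n)).deleteEdges
    {e | ∃ _h : 2 ≤ n, e = s(⟨0, by omega⟩, ⟨1, by omega⟩)}

/-- `Cfun n q = Rel(K_n; q)`. -/
def Cfun (n : ℕ) (q : ℝ) : ℝ := relPoly (⊤ : SimpleGraph (Fin n)) q

/-- `Rfun n q = Rel(H_n; q)` where `H_n = K_n` minus an edge. -/
def Rfun (n : ℕ) (q : ℝ) : ℝ := relPoly (Hgraph n) q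

/-- `Sfun n q = S(H_n; q)`, the split reliability of `K_n` minus the edge `uv`,
with terminals `u`, `v` the endpoints of the deleted edge. -/
def Sfun (n : ℕ) (q : ℝ) : ℝ :=
  if h : 2 ≤ n then splitRel (Hgraph n) ⟨0, by omega⟩ ⟨1, by omega⟩ q else 0

/-- `yfun n q = ŷ_{H_n}(q)`. -/
def yfun (n : ℕ) (q : ℝ) : ℝ := Rfun n q / Sfun n q + 1

/-- The edges of the complete graph on the vertex set `U`. -/
def edgesOn {V : Type} [DecidableEq V] (U : Finset V) : Finset (Sym2 V) :=
  U.offDiag.image (Function.uncurry Sym2.mk)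

lemma mk_mem_edgesOn {V : Type} [DecidableEq V] {U : Finset V} {a b : V} :
    s(a, b) ∈ edgesOn U ↔ a ∈ U ∧ b ∈ U ∧ a ≠ b := by
  simp only [edgesOn, mem_image, mem_offDiag, Prod.exists, Function.uncurry_apply_pair]
  constructor
  · rintro ⟨x, y, ⟨hx, hy, hxy⟩, h⟩
    rcases Sym2.eq_iff.1 h with ⟨rfl, rfl⟩ | ⟨rfl, rfl⟩
    · exact ⟨hx, hy, hxy⟩
    · exact ⟨hy, hx, hxy.symm⟩
  · intro h
    exact ⟨a, b, h, rfl⟩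

lemma card_edgesOn {V : Type} [DecidableEq V] (U : Finset V) :
    #(edgesOn U) = (#U).choose 2 :=
  Sym2.card_image_offDiag U

lemma disjoint_edgesOn {V : Type} [DecidableEq V] {U W : Finset V} (h : Disjoint U W) :
    Disjoint (edgesOn U) (edgesOn W) := by
  rw [Finset.disjoint_left] at h ⊢
  intro e
  induction e using Sym2.ind with
  | _ a b =>
    intro h1 h2
    exact h (mk_mem_edgesOn.1 h1).1 (mk_mem_edgesOn.1 h2).1

lemma card_edgesOn_univ {V : Type} [Fintype V] [DecidableEq V] (U : Finset V) :
    #(edgesOn (univ : Finset V)) = #(edgesOn U) + #(edgesOn Uᶜ) + #U * #Uᶜ := by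
  rw [card_edgesOn, card_edgesOn, card_edgesOn, card_univ, ← Finset.card_add_card_compl U]
  qify
  rw [Nat.cast_choose_two, Nat.cast_choose_two, Nat.cast_choose_two]
  push_cast
  ring

lemma edgeFin_top (V : Type) [Fintype V] [DecidableEq V] :
    edgeFin (⊤ : SimpleGraph V) = edgesOn univ := by
  ext e
  induction e using Sym2.ind with
  | _ a b => simp [edgeFin, mk_mem_edgesOn]

/-- Reachability in the graph with edge set `A`. -/
abbrev EdgeReach {V : Type} (A : Finset (Sym2 V)) (x y : V) : Prop :=
  (SimpleGraph.fromEdgeSet (A : Set (Sym2 V))).Reachable x y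

lemma edgeReach_iff {V : Type} {A : Finset (Sym2 V)} {x y : V} :
    EdgeReach A x y ↔ Relation.ReflTransGen (fun a b => s(a, b) ∈ A) x y := by
  rw [EdgeReach, reachable_fromEdgeSet_eq_reflTransGen_toRel]
  rfl

lemma EdgeReach.of_mem {V : Type} {A : Finset (Sym2 V)} {x y : V} (h : s(x, y) ∈ A) :
    EdgeReach A x y :=
  edgeReach_iff.2 (Relation.ReflTransGen.single h)

lemma EdgeReach.mono {V : Type} {A B : Finset (Sym2 V)} (hAB : A ⊆ B) {x y : V}
    (h : EdgeReach A x y) : EdgeReach B x y :=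
  edgeReach_iff.2 (Relation.ReflTransGen.mono (fun _ _ hab => hAB hab) _ _ (edgeReach_iff.1 h))

lemma edgeReach_union {V : Type} [Fintype V] [DecidableEq V] {U : Finset V}
    {A B : Finset (Sym2 V)} (hA : A ⊆ edgesOn U) (hB : B ⊆ edgesOn Uᶜ) {x y : V} (hx : x ∈ U) :
    EdgeReach (A ∪ B) x y ↔ y ∈ U ∧ EdgeReach A x y := by
  refine ⟨fun h => ?_, fun h => h.2.mono subset_union_left⟩
  induction edgeReach_iff.1 h with
  | refl => exact ⟨hx, Reachable.refl _⟩
  | @tail b c hab hbc ih =>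
    obtain ⟨hb, hr⟩ := ih (edgeReach_iff.2 hab)
    rcases mem_union.1 hbc with hbc | hbc
    · exact ⟨(mk_mem_edgesOn.1 (hA hbc)).2.1, hr.trans (EdgeReach.of_mem hbc)⟩
    · exact absurd hb (mem_compl.1 (mk_mem_edgesOn.1 (hB hbc)).1)

lemma edgeReach_map {V W : Type} (f : V ↪ W) {A : Finset (Sym2 V)} {x y : V} :
    EdgeReach (A.map f.sym2Map) (f x) (f y) ↔ EdgeReach A x y := by
  constructor
  · intro h
    have key : ∀ z, EdgeReach (A.map f.sym2Map) (f x) z → ∃ y, z = f y ∧ EdgeReach A x y := by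
      intro z hz
      induction edgeReach_iff.1 hz with
      | refl => exact ⟨x, rfl, Reachable.refl _⟩
      | @tail b c hab hbc ih =>
        obtain ⟨b', rfl, hr⟩ := ih (edgeReach_iff.2 hab)
        obtain ⟨e, he, heq⟩ := mem_map.1 hbc
        induction e using Sym2.ind with
        | _ p r =>
          have heq' : s(f p, f r) = s(f b', c) := heq
          rcases Sym2.eq_iff.1 heq' with ⟨h1, rfl⟩ | ⟨rfl, h1⟩
          · rw [← f.injective h1] at hr
            exact ⟨r, rfl, hr.trans (EdgeReach.of_mem he)⟩
          · rw [← f.injective h1] at hr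
            exact ⟨p, rfl, hr.trans (EdgeReach.of_mem (Sym2.eq_swap ▸ he))⟩
    obtain ⟨y', hy, hr⟩ := key _ h
    rwa [f.injective hy]
  · intro h
    refine edgeReach_iff.2 ((edgeReach_iff.1 h).lift f fun a b hab => ?_)
    exact mem_map.2 ⟨s(a, b), hab, rfl⟩

/-- All vertices of `U` are connected to each other through edges of `A`. -/
def ConnectsOn {V : Type} (U : Finset V) (A : Finset (Sym2 V)) : Prop :=
  ∀ x ∈ U, ∀ y ∈ U, EdgeReach A x y

lemma connectsOn_iff_of_mem {V : Type} {U : Finset V} {A : Finset (Sym2 V)} {u : V}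
    (hu : u ∈ U) : ConnectsOn U A ↔ ∀ y ∈ U, EdgeReach A u y :=
  ⟨fun h => h u hu, fun h x hx y hy => (h x hx).symm.trans (h y hy)⟩

lemma connectsOn_univ_iff {V : Type} [Fintype V] [Nonempty V] {A : Finset (Sym2 V)} :
    ConnectsOn univ A ↔ (SimpleGraph.fromEdgeSet (A : Set (Sym2 V))).Connected := by
  simp [ConnectsOn, connected_iff, Preconnected, EdgeReach, *]

/-- The probability that precisely the edges in `A`, among those in `E`, are operational. -/
def edgeWeight {V : Type} (q : ℝ) (E A : Finset (Sym2 V)) : ℝ :=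
  (1 - q) ^ #A * q ^ (#E - #A)

lemma sum_edgeWeight {V : Type} (q : ℝ) (E : Finset (Sym2 V)) :
    ∑ A ∈ E.powerset, edgeWeight q E A = 1 := by
  simp only [edgeWeight]
  rw [Finset.sum_pow_mul_eq_add_pow]
  simp

open Classical in
/-- The reliability of the complete graph on the vertex set `U`. -/
def connSum {V : Type} (q : ℝ) (U : Finset V) : ℝ :=
  ∑ A ∈ (edgesOn U).powerset, if ConnectsOn U A then edgeWeight q (edgesOn U) A else 0

lemma map_edgesOn {V W : Type} [DecidableEq V] [DecidableEq W] (f : V ↪ W) (U : Finset V) :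
    edgesOn (U.map f) = (edgesOn U).map f.sym2Map := by
  ext e
  constructor
  · induction e using Sym2.ind with
    | _ a b =>
      intro h
      obtain ⟨ha, hb, hab⟩ := mk_mem_edgesOn.1 h
      obtain ⟨a, ha', rfl⟩ := mem_map.1 ha
      obtain ⟨b, hb', rfl⟩ := mem_map.1 hb
      exact mem_map.2 ⟨s(a, b), mk_mem_edgesOn.2 ⟨ha', hb', fun h => hab (h ▸ rfl)⟩, rfl⟩
  · intro h
    obtain ⟨e, he, rfl⟩ := mem_map.1 h
    induction e using Sym2.ind with
    | _ a b =>
      obtain ⟨ha, hb, hab⟩ := mk_mem_edgesOn.1 he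
      exact mk_mem_edgesOn.2 ⟨mem_map_of_mem f ha, mem_map_of_mem f hb,
        fun h => hab (f.injective h)⟩

lemma connectsOn_map {V W : Type} (f : V ↪ W) {U : Finset V} {A : Finset (Sym2 V)} :
    ConnectsOn (U.map f) (A.map f.sym2Map) ↔ ConnectsOn U A := by
  simp only [ConnectsOn, mem_map, forall_exists_index, and_imp, forall_apply_eq_imp_iff₂,
    edgeReach_map]

lemma connSum_map {V W : Type} (q : ℝ) (f : V ↪ W) (U : Finset V) :
    connSum q (U.map f) = connSum q U := by
  classical
  symm
  rw [connSum, connSum]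
  refine Finset.sum_bij (fun A _ => A.map f.sym2Map) ?_ ?_ ?_ ?_
  · intro A hA
    rw [mem_powerset] at hA ⊢
    convert Finset.map_subset_map.2 hA using 1
    convert map_edgesOn f U
  · intro A _ B _ h
    exact Finset.map_injective _ h
  · intro B hB
    rw [mem_powerset] at hB
    have hB' : B ⊆ (edgesOn U).map f.sym2Map := by
      convert hB using 1
      convert (map_edgesOn f U).symm
    obtain ⟨A, hA, rfl⟩ := Finset.subset_map_iff.1 hB'
    refine ⟨A, ?_, rfl⟩
    rw [mem_powerset]
    convert hA
  · intro A _
    simp only [connectsOn_map, edgeWeight, card_map, card_edgesOn]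

lemma connSum_univ {V : Type} [Fintype V] [Nonempty V] (q : ℝ) :
    connSum q (univ : Finset V) = relPoly (⊤ : SimpleGraph V) q := by
  classical
  rw [connSum, relPoly, edgeFin_top]
  refine Finset.sum_congr (by congr!) fun A _ => ?_
  simp only [connectsOn_univ_iff, edgeWeight, card_edgesOn]

lemma connSum_eq_Cfun {V : Type} (q : ℝ) {U : Finset V} (hU : U.Nonempty) :
    connSum q U = Cfun #U q := by
  classical
  have : Nonempty (Fin #U) := Fin.pos_iff_nonempty.1 hU.card_pos
  let f : Fin #U ↪ V := U.equivFin.symm.toEmbedding.trans (Function.Embedding.subtype _)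
  have hf : (univ : Finset (Fin #U)).map f = U := by
    ext x
    simp only [mem_map, mem_univ, true_and]
    constructor
    · rintro ⟨i, rfl⟩
      exact (U.equivFin.symm i).2
    · intro hx
      exact ⟨U.equivFin ⟨x, hx⟩, by simp [f]⟩
  rw [Cfun, ← connSum_univ, ← connSum_map q f, hf]

open Classical in
lemma sum_edgeWeight_mul {V : Type} [Fintype V] [DecidableEq V] (q : ℝ) (U : Finset V)
    {P Q R : Finset (Sym2 V) → Prop}
    (hR : ∀ A ⊆ edgesOn univ, R A ↔ ∃ B ⊆ edgesOn U, ∃ C ⊆ edgesOn Uᶜ, A = B ∪ C ∧ P B ∧ Q C) :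
    ∑ A ∈ (edgesOn univ).powerset, (if R A then edgeWeight q (edgesOn univ) A else 0) =
      q ^ (#U * #Uᶜ) *
        ((∑ B ∈ (edgesOn U).powerset, if P B then edgeWeight q (edgesOn U) B else 0) *
          ∑ C ∈ (edgesOn Uᶜ).powerset, if Q C then edgeWeight q (edgesOn Uᶜ) C else 0) := by
  have hdisj : Disjoint (edgesOn U) (edgesOn Uᶜ) := disjoint_edgesOn disjoint_compl_right
  have hsub : ∀ W : Finset V, edgesOn W ⊆ edgesOn univ := by
    intro W e
    induction e using Sym2.ind with
    | _ a b =>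
      intro h
      exact mk_mem_edgesOn.2 ⟨mem_univ _, mem_univ _, (mk_mem_edgesOn.1 h).2.2⟩
  rw [← Finset.sum_filter, ← Finset.sum_filter, ← Finset.sum_filter, Finset.sum_mul_sum,
    ← Finset.sum_product', Finset.mul_sum]
  symm
  refine Finset.sum_bij (fun BC _ => BC.1 ∪ BC.2) ?_ ?_ ?_ ?_
  · rintro ⟨B, C⟩ h
    simp only [mem_product, mem_filter, mem_powerset] at h ⊢
    obtain ⟨⟨hB, hP⟩, hC, hQ⟩ := h
    have hBC : B ∪ C ⊆ edgesOn univ := union_subset (hB.trans (hsub _)) (hC.trans (hsub _))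
    exact ⟨hBC, (hR _ hBC).2 ⟨B, hB, C, hC, rfl, hP, hQ⟩⟩
  · rintro ⟨B, C⟩ h ⟨B', C'⟩ h' heq
    simp only [mem_product, mem_filter, mem_powerset] at h h' heq
    have key : ∀ B ⊆ edgesOn U, ∀ C ⊆ edgesOn Uᶜ,
        (B ∪ C) ∩ edgesOn U = B ∧ (B ∪ C) ∩ edgesOn Uᶜ = C := by
      intro B hB C hC
      rw [union_inter_distrib_right, union_inter_distrib_right, inter_eq_left.2 hB,
        inter_eq_left.2 hC, disjoint_iff_inter_eq_empty.1 (hdisj.mono_left hB),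
        disjoint_iff_inter_eq_empty.1 (hdisj.symm.mono_left hC)]
      simp
    have h1 := key B h.1.1 C h.2.1
    have h2 := key B' h'.1.1 C' h'.2.1
    rw [heq] at h1
    exact Prod.ext (h1.1.symm.trans h2.1) (h1.2.symm.trans h2.2)
  · intro A hA
    rw [mem_filter, mem_powerset] at hA
    obtain ⟨B, hB, C, hC, rfl, hP, hQ⟩ := (hR A hA.1).1 hA.2
    exact ⟨(B, C), by simp [hB, hC, hP, hQ], rfl⟩
  · rintro ⟨B, C⟩ h
    simp only [mem_product, mem_filter, mem_powerset] at h
    have hB := card_le_card h.1.1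
    have hC := card_le_card h.2.1
    simp only [edgeWeight]
    rw [card_edgesOn_univ U, card_union_of_disjoint (hdisj.mono h.1.1 h.2.1),
      show #(edgesOn U) + #(edgesOn Uᶜ) + #U * #Uᶜ - (#B + #C) =
        #U * #Uᶜ + (#(edgesOn U) - #B) + (#(edgesOn Uᶜ) - #C) by omega]
    ring

lemma component_eq_iff {V : Type} [Fintype V] [DecidableEq V] {U : Finset V} {u : V}
    (hu : u ∈ U) {A : Finset (Sym2 V)} (hA : A ⊆ edgesOn univ) :
    (∀ y, EdgeReach A u y ↔ y ∈ U) ↔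
      ∃ B ⊆ edgesOn U, ∃ C ⊆ edgesOn Uᶜ, A = B ∪ C ∧ ConnectsOn U B := by
  constructor
  · intro h
    have hAU : A = A ∩ edgesOn U ∪ A ∩ edgesOn Uᶜ := by
      refine Subset.antisymm ?_ (union_subset inter_subset_left inter_subset_left)
      intro e he
      induction e using Sym2.ind with
      | _ a b =>
        have hab := (mk_mem_edgesOn.1 (hA he)).2.2
        have hiff : a ∈ U ↔ b ∈ U := by
          rw [← h a, ← h b]
          exact ⟨fun h => h.trans (EdgeReach.of_mem he), fun h => h.trans (EdgeReach.of_mem he).symm⟩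
        by_cases ha : a ∈ U
        · exact mem_union_left _ (mem_inter.2 ⟨he, mk_mem_edgesOn.2 ⟨ha, hiff.1 ha, hab⟩⟩)
        · exact mem_union_right _ (mem_inter.2 ⟨he, mk_mem_edgesOn.2
            ⟨mem_compl.2 ha, mem_compl.2 fun hb => ha (hiff.2 hb), hab⟩⟩)
    refine ⟨_, inter_subset_right, _, inter_subset_right, hAU, (connectsOn_iff_of_mem hu).2 ?_⟩
    intro y hy
    have := (h y).2 hy
    rw [hAU] at this
    exact ((edgeReach_union inter_subset_right inter_subset_right hu).1 this).2
  · rintro ⟨B, hB, C, hC, rfl, hconn⟩ y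
    rw [edgeReach_union hB hC hu]
    exact ⟨fun h => h.1, fun h => ⟨h, hconn u hu y h⟩⟩

lemma split_component_iff {V : Type} [Fintype V] [DecidableEq V] {U : Finset V} {u v : V}
    (hu : u ∈ U) (hv : v ∉ U) {A : Finset (Sym2 V)} (hA : A ⊆ edgesOn univ) :
    ((∀ y, EdgeReach A u y ↔ y ∈ U) ∧ ∀ y ∈ Uᶜ, EdgeReach A v y) ↔
      ∃ B ⊆ edgesOn U, ∃ C ⊆ edgesOn Uᶜ, A = B ∪ C ∧ ConnectsOn U B ∧ ConnectsOn Uᶜ C := by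
  have hv' : v ∈ Uᶜ := mem_compl.2 hv
  rw [component_eq_iff hu hA]
  constructor
  · rintro ⟨⟨B, hB, C, hC, rfl, hconn⟩, h⟩
    refine ⟨B, hB, C, hC, rfl, hconn, (connectsOn_iff_of_mem hv').2 fun y hy => ?_⟩
    have := h y hy
    rw [union_comm] at this
    exact ((edgeReach_union hC (by rwa [compl_compl]) hv').1 this).2
  · rintro ⟨B, hB, C, hC, rfl, hconn, hconn'⟩
    exact ⟨⟨B, hB, C, hC, rfl, hconn⟩, fun y hy => (hconn' v hv' y hy).mono subset_union_right⟩

open Classical in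
lemma sum_component_fiberwise {V : Type} [Fintype V] (u : V) (E : Finset (Finset (Sym2 V)))
    (f : Finset (Sym2 V) → ℝ) :
    ∑ A ∈ E, f A = ∑ U : Finset V, ∑ A ∈ E, if ∀ y, EdgeReach A u y ↔ y ∈ U then f A else 0 := by
  rw [← Finset.sum_fiberwise E (fun A => univ.filter (EdgeReach A u)) f]
  refine Finset.sum_congr rfl fun U _ => ?_
  rw [Finset.sum_filter]
  refine Finset.sum_congr rfl fun A _ => ?_
  simp [Finset.ext_iff]

theorem sum_choose_mul_Cfun (N : ℕ) (q : ℝ) :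
    ∑ k ∈ range (N + 1), (N.choose k : ℝ) * (q ^ ((k + 1) * (N - k)) * Cfun (k + 1) q) = 1 := by
  classical
  let u : Fin (N + 1) := 0
  let s : Finset (Fin (N + 1)) := univ.erase u
  have hus : u ∉ s := notMem_erase _ _
  have huniv : (univ : Finset (Fin (N + 1))) = insert u s := (insert_erase (mem_univ u)).symm
  have hs : #s = N := by simp [s]
  have h := sum_edgeWeight q (edgesOn (univ : Finset (Fin (N + 1))))
  rw [sum_component_fiberwise u, ← powerset_univ, huniv, sum_powerset_insert hus, ← huniv,
    Finset.sum_eq_zero, zero_add] at h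
  · have hcount := Finset.sum_powerset_apply_card
      (fun k => q ^ ((k + 1) * (N - k)) * Cfun (k + 1) q) (x := s)
    simp only [hs, nsmul_eq_mul] at hcount
    rw [← h, ← hcount]
    refine Finset.sum_congr rfl fun t ht => ?_
    have hut : u ∉ t := fun h => hus (mem_powerset.1 ht h)
    have hu : u ∈ insert u t := mem_insert_self _ _
    have key := sum_edgeWeight_mul (P := ConnectsOn (insert u t)) (Q := fun _ => True) q
      (insert u t) fun A hA => (component_eq_iff hu hA).trans (by simp only [and_true])
    simp only [if_true] at key
    rw [sum_edgeWeight, mul_one, card_compl, card_insert_of_notMem hut, Fintype.card_fin,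
      Nat.add_sub_add_right] at key
    rw [← card_insert_of_notMem hut, ← connSum_eq_Cfun q ⟨u, hu⟩, card_insert_of_notMem hut,
      connSum]
    convert key.symm using 1
    · congr!
    · congr!
  · intro t ht
    refine Finset.sum_eq_zero fun A _ => if_neg fun h => ?_
    exact hus (mem_powerset.1 ht ((h u).1 (Reachable.refl _)))

theorem splitRel_top (m : ℕ) {u v : Fin (m + 2)} (huv : u ≠ v) (q : ℝ) :
    splitRel (⊤ : SimpleGraph (Fin (m + 2))) u v q =
      ∑ k ∈ range (m + 1), (m.choose k : ℝ) *
        (q ^ ((k + 1) * (m - k + 1)) * (Cfun (k + 1) q * Cfun (m - k + 1) q)) := by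
  classical
  let s : Finset (Fin (m + 2)) := (univ.erase u).erase v
  have hvs : v ∉ s := notMem_erase _ _
  have hus : u ∉ insert v s := by simp [s, huv]
  have huniv : (univ : Finset (Fin (m + 2))) = insert u (insert v s) := by
    rw [insert_erase (mem_erase.2 ⟨huv.symm, mem_univ v⟩), insert_erase (mem_univ u)]
  have hs : #s = m := by
    rw [card_erase_of_mem (mem_erase.2 ⟨huv.symm, mem_univ v⟩), card_erase_of_mem (mem_univ u)]
    simp
  rw [splitRel, edgeFin_top, sum_component_fiberwise u, ← powerset_univ, huniv,
    sum_powerset_insert hus, ← huniv, Finset.sum_eq_zero, zero_add, sum_powerset_insert hvs,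
    add_eq_left.2 (Finset.sum_eq_zero ?_)]
  · have hcount := Finset.sum_powerset_apply_card
      (fun k => q ^ ((k + 1) * (m - k + 1)) * (Cfun (k + 1) q * Cfun (m - k + 1) q)) (x := s)
    simp only [hs, nsmul_eq_mul] at hcount
    rw [← hcount]
    refine Finset.sum_congr rfl fun t ht => ?_
    have hut : u ∉ t := fun h => hus (mem_insert_of_mem (mem_powerset.1 ht h))
    have hvt : v ∉ t := fun h => hvs (mem_powerset.1 ht h)
    have hu : u ∈ insert u t := mem_insert_self _ _
    have hv : v ∉ insert u t := by simp [huv.symm, hvt]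
    have hcard : #t ≤ m := (card_le_card (mem_powerset.1 ht)).trans_eq hs
    have hcompl : #(insert u t)ᶜ = m - #t + 1 := by
      rw [card_compl, card_insert_of_notMem hut, Fintype.card_fin]
      omega
    have key := sum_edgeWeight_mul q (insert u t) fun A hA => split_component_iff hu hv hA
    rw [hcompl, card_insert_of_notMem hut] at key
    rw [← card_insert_of_notMem hut, ← connSum_eq_Cfun q ⟨u, hu⟩, ← hcompl,
      ← connSum_eq_Cfun q ⟨v, mem_compl.2 hv⟩, hcompl, card_insert_of_notMem hut, connSum, connSum]
    convert key using 1
    swap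
    · congr!
    refine Finset.sum_congr rfl fun A _ => ?_
    by_cases h : ∀ y, EdgeReach A u y ↔ y ∈ insert u t
    · simp only [h, hv, implies_true, if_true, true_and, not_false_eq_true, mem_compl,
        ← or_iff_not_imp_left]
      rfl
    · rw [if_neg h, if_neg fun h' => h h'.1]
  · intro t ht
    refine Finset.sum_eq_zero fun A _ => ?_
    by_cases h : ∀ y, EdgeReach A u y ↔ y ∈ insert u (insert v t)
    · rw [if_pos h, if_neg]
      exact fun h' => h'.1 ((h v).2 (by simp))
    · rw [if_neg h]
  · intro t ht
    refine Finset.sum_eq_zero fun A _ => if_neg fun h => ?_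
    exact hus (mem_powerset.1 ht ((h u).1 (Reachable.refl _)))

lemma edgeReach_insert {V : Type} [DecidableEq V] {A : Finset (Sym2 V)} {u v w : V} :
    EdgeReach (insert s(u, v) A) u w ↔ EdgeReach A u w ∨ EdgeReach A v w := by
  constructor
  · intro h
    induction edgeReach_iff.1 h with
    | refl => exact Or.inl (Reachable.refl _)
    | @tail b c hab hbc ih =>
      rcases mem_insert.1 hbc with hbc | hbc
      · rcases Sym2.eq_iff.1 hbc with ⟨-, rfl⟩ | ⟨-, rfl⟩
        · exact Or.inr (Reachable.refl _)
        · exact Or.inl (Reachable.refl _)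
      · exact (ih (edgeReach_iff.2 hab)).imp (fun h => h.trans (EdgeReach.of_mem hbc))
          fun h => h.trans (EdgeReach.of_mem hbc)
  · rintro (h | h)
    · exact h.mono (subset_insert _ _)
    · exact (EdgeReach.of_mem (mem_insert_self _ _)).trans (h.mono (subset_insert _ _))

lemma connectsOn_univ_insert {V : Type} [Fintype V] [DecidableEq V] {A : Finset (Sym2 V)}
    {u v : V} :
    ConnectsOn univ (insert s(u, v) A) ↔
      ConnectsOn univ A ∨ (¬ EdgeReach A u v ∧ ∀ w, EdgeReach A u w ∨ EdgeReach A v w) := by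
  rw [connectsOn_iff_of_mem (mem_univ u), connectsOn_iff_of_mem (mem_univ u)]
  simp only [mem_univ, forall_true_left, edgeReach_insert]
  by_cases huv : EdgeReach A u v
  · simp only [huv, not_true_eq_false, false_and, or_false]
    exact forall_congr' fun w => or_iff_left_of_imp huv.trans
  · simp only [huv, not_false_eq_true, true_and]
    exact (or_iff_right fun h => huv (h v)).symm

lemma edgeFin_Hgraph (m : ℕ) :
    edgeFin (Hgraph (m + 2)) = (edgesOn (univ : Finset (Fin (m + 2)))).erase s(0, 1) := by
  ext e
  induction e using Sym2.ind with
  | _ a b =>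
    rw [mem_erase, mk_mem_edgesOn, edgeFin, Set.Finite.mem_toFinset, mem_edgeSet, Hgraph,
      deleteEdges_adj]
    simp only [top_adj, mem_univ, true_and, Set.mem_ofPred_eq]
    constructor
    · rintro ⟨h1, h2⟩
      exact ⟨fun h => h2 ⟨by omega, h⟩, h1⟩
    · rintro ⟨h1, h2⟩
      exact ⟨h2, fun h => h1 h.2⟩

lemma insert_edgeFin_Hgraph (m : ℕ) :
    edgeFin (⊤ : SimpleGraph (Fin (m + 2))) = insert s(0, 1) (edgeFin (Hgraph (m + 2))) := by
  rw [edgeFin_top, edgeFin_Hgraph, insert_erase]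
  exact mk_mem_edgesOn.2 ⟨mem_univ _, mem_univ _, by simp⟩

lemma notMem_edgeFin_Hgraph (m : ℕ) : s(0, 1) ∉ edgeFin (Hgraph (m + 2)) := by
  rw [edgeFin_Hgraph]
  exact notMem_erase _ _

lemma Sfun_add_two (m : ℕ) (q : ℝ) : Sfun (m + 2) q = splitRel (Hgraph (m + 2)) 0 1 q :=
  dif_pos (Nat.le_add_left 2 m)

lemma splitRel_top_eq (m : ℕ) (q : ℝ) :
    splitRel (⊤ : SimpleGraph (Fin (m + 2))) 0 1 q = q * Sfun (m + 2) q := by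
  have he := notMem_edgeFin_Hgraph m
  rw [Sfun_add_two, splitRel, splitRel, insert_edgeFin_Hgraph, sum_powerset_insert he,
    add_eq_left.2 (Finset.sum_eq_zero ?_), Finset.mul_sum]
  · refine Finset.sum_congr rfl fun A hA => ?_
    have hcard := card_le_card (mem_powerset.1 hA)
    rw [card_insert_of_notMem he, mul_ite, mul_zero, Nat.sub_add_comm hcard]
    congr 1
    ring
  · intro A _
    exact if_neg fun h => h.1 (EdgeReach.of_mem (mem_insert_self _ _))

theorem Cfun_eq_Rfun_add (m : ℕ) (q : ℝ) :
    Cfun (m + 2) q = Rfun (m + 2) q + (1 - q) * Sfun (m + 2) q := by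
  classical
  have he := notMem_edgeFin_Hgraph m
  rw [Sfun_add_two, Cfun, Rfun, relPoly, relPoly, splitRel, insert_edgeFin_Hgraph,
    sum_powerset_insert he, Finset.mul_sum, ← Finset.sum_add_distrib, ← Finset.sum_add_distrib]
  refine Finset.sum_congr rfl fun A hA => ?_
  have hcard := card_le_card (mem_powerset.1 hA)
  have heA : s(0, 1) ∉ A := fun h => he (mem_powerset.1 hA h)
  rw [card_insert_of_notMem he, card_insert_of_notMem heA, Nat.sub_add_comm hcard,
    Nat.add_sub_add_right]
  simp only [← connectsOn_univ_iff, connectsOn_univ_insert]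
  by_cases h : ConnectsOn univ A
  · have h01 : EdgeReach A 0 1 := h 0 (mem_univ _) 1 (mem_univ _)
    simp only [h, h01, true_or, if_true, not_true_eq_false, false_and, if_false]
    ring
  · simp only [h, false_or, if_false, zero_add, mul_ite, mul_zero]
    congr 1
    ring

/-- The sum `T_m` with `S_{m+2}(q) = q ^ m * T_m(q)`. -/
def splitFactor (m : ℕ) (q : ℝ) : ℝ :=
  ∑ k ∈ range (m + 1), (m.choose k : ℝ) *
    (q ^ (k * (m - k)) * (Cfun (k + 1) q * Cfun (m - k + 1) q))

theorem Sfun_eq_splitFactor (m : ℕ) {q : ℝ} (hq : q ≠ 0) :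
    Sfun (m + 2) q = q ^ m * splitFactor m q := by
  refine mul_left_cancel₀ hq ?_
  rw [← splitRel_top_eq, splitRel_top m (by simp), splitFactor, ← mul_assoc, ← pow_succ',
    Finset.mul_sum]
  refine Finset.sum_congr rfl fun k hk => ?_
  obtain ⟨l, rfl⟩ := Nat.exists_eq_add_of_le (Nat.lt_succ_iff.1 (mem_range.1 hk))
  rw [Nat.add_sub_cancel_left, show (k + 1) * (l + 1) = (k + l + 1) + k * l by ring, pow_add]
  ring

theorem yfun_eq (m : ℕ) {q : ℝ} (hq : q ≠ 0) (hT : splitFactor m q ≠ 0) :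
    2 * q ^ m * yfun (m + 2) q = 2 * Cfun (m + 2) q / splitFactor m q + 2 * q ^ (m + 1) := by
  have hC := Cfun_eq_Rfun_add m q
  rw [yfun, hC, Sfun_eq_splitFactor m hq]
  field_simp
  ring

/-- The sum `∑_{0 < k < m} (m choose k) r ^ (k (m - k))`. -/
def chooseTail (r : ℝ) (m : ℕ) : ℝ :=
  ∑ k ∈ Ioo 0 m, (m.choose k : ℝ) * r ^ (k * (m - k))

lemma chooseTail_nonneg {r : ℝ} (hr : 0 ≤ r) (m : ℕ) : 0 ≤ chooseTail r m :=
  Finset.sum_nonneg fun _ _ => by positivity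

open Filter in
lemma tendsto_chooseTail {r : ℝ} (hr : 0 ≤ r) (hr1 : r < 1) :
    Tendsto (chooseTail r) atTop (nhds 0) := by
  obtain ⟨ρ, hρ0, hρ1, rfl⟩ : ∃ ρ : ℝ, 0 ≤ ρ ∧ ρ < 1 ∧ r = ρ ^ 2 :=
    ⟨√r, Real.sqrt_nonneg r, by rwa [Real.sqrt_lt' one_pos, one_pow], (Real.sq_sqrt hr).symm⟩
  have habs : |ρ| < 1 := by rwa [abs_of_nonneg hρ0]
  have h1 := tendsto_pow_const_mul_const_pow_of_abs_lt_one 1 habs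
  have h2 := tendsto_pow_const_mul_const_pow_of_abs_lt_one 2 habs
  refine squeeze_zero' (Eventually.of_forall (chooseTail_nonneg hr)) ?_ h2
  filter_upwards [h1.eventually_le_const one_pos] with m hm
  rw [pow_one] at hm
  have hx0 : 0 ≤ (m : ℝ) * ρ ^ m := by positivity
  have key : ∀ j, 0 < j → 2 * j ≤ m → (m.choose j : ℝ) * (ρ ^ 2) ^ (j * (m - j)) ≤ m * ρ ^ m := by
    intro j hj hjm
    calc (m.choose j : ℝ) * (ρ ^ 2) ^ (j * (m - j)) ≤ (m : ℝ) ^ j * ρ ^ (m * j) := by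
          gcongr
          · exact_mod_cast Nat.choose_le_pow m j
          · rw [← pow_mul]
            refine pow_le_pow_of_le_one hρ0 hρ1.le ?_
            obtain ⟨i, rfl⟩ := Nat.exists_eq_add_of_le hjm
            rw [show 2 * j + i - j = j + i by omega]
            nlinarith
      _ = (m * ρ ^ m) ^ j := by rw [pow_mul, mul_pow]
      _ ≤ m * ρ ^ m := pow_le_of_le_one hx0 hm hj.ne'
  calc chooseTail (ρ ^ 2) m ≤ ∑ k ∈ Ioo 0 m, (m : ℝ) * ρ ^ m := by
        refine Finset.sum_le_sum fun k hk => ?_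
        obtain ⟨hk0, hkm⟩ := mem_Ioo.1 hk
        rcases le_total (2 * k) m with h | h
        · exact key k hk0 h
        · have := key (m - k) (by omega) (by omega)
          rwa [Nat.choose_symm hkm.le, Nat.sub_sub_self hkm.le, mul_comm (m - k)] at this
    _ ≤ m * (m * ρ ^ m) := by
        rw [Finset.sum_const, nsmul_eq_mul]
        gcongr
        simp
    _ = (m : ℝ) ^ 2 * ρ ^ m := by ring

lemma Cfun_one (q : ℝ) : Cfun 1 q = 1 := by
  simpa using sum_choose_mul_Cfun 0 q

lemma abs_Cfun_sub_one_le {r M q : ℝ} (hr1 : r ≤ 1) (hq : |q| ≤ r) (N : ℕ)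
    (hM : ∀ k < N, |Cfun (k + 1) q| ≤ M) (hM0 : 0 ≤ M) :
    |Cfun (N + 1) q - 1| ≤ M * (r ^ N + chooseTail r N) := by
  have hr : 0 ≤ r := (abs_nonneg q).trans hq
  rcases Nat.eq_zero_or_pos N with rfl | hN
  · simpa [Cfun_one, chooseTail] using hM0
  have hC : Cfun (N + 1) q - 1 =
      -∑ k ∈ range N, (N.choose k : ℝ) * (q ^ ((k + 1) * (N - k)) * Cfun (k + 1) q) := by
    have h := sum_choose_mul_Cfun N q
    rw [Finset.sum_range_succ] at h
    simp only [Nat.choose_self, Nat.cast_one, Nat.sub_self, mul_zero, pow_zero, one_mul] at h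
    linarith
  have hterm : ∀ k < N, ∀ e ≤ (k + 1) * (N - k),
      |(N.choose k : ℝ) * (q ^ ((k + 1) * (N - k)) * Cfun (k + 1) q)| ≤
        M * ((N.choose k : ℝ) * r ^ e) := by
    intro k hk e he
    rw [abs_mul, abs_mul, abs_pow, Nat.abs_cast]
    calc (N.choose k : ℝ) * (|q| ^ ((k + 1) * (N - k)) * |Cfun (k + 1) q|)
        ≤ N.choose k * (r ^ e * M) := by
          gcongr
          · exact (pow_le_pow_left₀ (abs_nonneg q) hq _).trans (pow_le_pow_of_le_one hr hr1 he)
          · exact hM k hk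
      _ = _ := by ring
  have hrange : range N = insert 0 (Ioo 0 N) := by
    ext k
    simp only [mem_range, mem_insert, mem_Ioo]
    omega
  rw [hC, abs_neg, hrange, Finset.sum_insert (by simp), mul_add, chooseTail, Finset.mul_sum]
  refine (abs_add_le _ _).trans (add_le_add ?_ ((Finset.abs_sum_le_sum_abs _ _).trans
    (Finset.sum_le_sum fun k hk => ?_)))
  · simpa using hterm 0 hN N (by simp)
  · exact hterm k (mem_Ioo.1 hk).2 _ (Nat.mul_le_mul_right _ (Nat.le_succ k))

lemma exists_abs_Cfun_le {r : ℝ} (hr : 0 ≤ r) (hr1 : r < 1) :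
    ∃ M : ℝ, ∀ q : ℝ, |q| ≤ r → ∀ k, |Cfun (k + 1) q| ≤ M := by
  have hinit : ∀ n : ℕ, ∃ M : ℝ, 0 ≤ M ∧ ∀ q : ℝ, |q| ≤ r → ∀ k < n, |Cfun (k + 1) q| ≤ M := by
    intro n
    induction n with
    | zero => exact ⟨0, le_rfl, fun _ _ k hk => absurd hk (Nat.not_lt_zero k)⟩
    | succ n ih =>
      obtain ⟨M, hM0, hM⟩ := ih
      refine ⟨max M (1 + |M * (r ^ n + chooseTail r n)|), hM0.trans (le_max_left _ _),
        fun q hq k hk => ?_⟩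
      rcases Nat.lt_succ_iff_lt_or_eq.1 hk with hk | rfl
      · exact (hM q hq k hk).trans (le_max_left _ _)
      · have h := abs_Cfun_sub_one_le hr1.le hq k (hM q hq) hM0
        have h' := abs_sub_abs_le_abs_sub (Cfun (k + 1) q) 1
        rw [abs_one] at h'
        refine le_trans ?_ (le_max_right _ _)
        linarith [le_abs_self (M * (r ^ k + chooseTail r k))]
  have hlim : Filter.Tendsto (fun n => r ^ n + chooseTail r n) Filter.atTop (nhds 0) := by
    simpa using (tendsto_pow_atTop_nhds_zero_of_lt_one hr hr1).add (tendsto_chooseTail hr hr1)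
  obtain ⟨N, hN⟩ := Filter.eventually_atTop.1 (hlim.eventually_le_const (half_pos one_pos))
  obtain ⟨M, -, hM⟩ := hinit N
  refine ⟨max M 2, fun q hq k => ?_⟩
  induction k using Nat.strong_induction_on with
  | _ k ih =>
    rcases lt_or_ge k N with hk | hk
    · exact (hM q hq k hk).trans (le_max_left _ _)
    · have h := abs_Cfun_sub_one_le hr1.le hq k ih (zero_le_two.trans (le_max_right M 2))
      have h' := abs_sub_abs_le_abs_sub (Cfun (k + 1) q) 1
      rw [abs_one] at h'
      have h2 := le_max_right M 2
      have h3 := mul_le_mul_of_nonneg_left (hN k hk) (zero_le_two.trans h2)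
      linarith

lemma abs_splitFactor_sub_le {r M q : ℝ} (hM : ∀ k, |Cfun (k + 1) q| ≤ M) (hq : |q| ≤ r)
    {m : ℕ} (hm : 0 < m) :
    |splitFactor m q - 2 * Cfun (m + 1) q| ≤ M ^ 2 * chooseTail r m := by
  have hM0 : 0 ≤ M := (abs_nonneg _).trans (hM 0)
  have hrange : range (m + 1) = insert 0 (insert m (Ioo 0 m)) := by
    ext k
    simp only [mem_range, mem_insert, mem_Ioo]
    omega
  rw [splitFactor, hrange, Finset.sum_insert (by simp [hm.ne]), Finset.sum_insert (by simp)]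
  simp only [Nat.choose_zero_right, Nat.choose_self, Nat.cast_one, zero_mul, Nat.sub_self,
    mul_zero, pow_zero, zero_add, Nat.sub_zero, one_mul, Cfun_one, mul_one]
  rw [show ∀ a b : ℝ, a + (a + b) - 2 * a = b by intros; ring, chooseTail, Finset.mul_sum]
  refine (Finset.abs_sum_le_sum_abs _ _).trans (Finset.sum_le_sum fun k _ => ?_)
  rw [abs_mul, abs_mul, abs_mul, abs_pow, Nat.abs_cast]
  calc (m.choose k : ℝ) * (|q| ^ (k * (m - k)) * (|Cfun (k + 1) q| * |Cfun (m - k + 1) q|))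
      ≤ m.choose k * (r ^ (k * (m - k)) * (M * M)) := by
        have := hM k
        have := hM (m - k)
        gcongr
        exact pow_nonneg ((abs_nonneg q).trans hq) _
    _ = _ := by ring

open Filter in
lemma exists_bound_yfun {r : ℝ} (hr : 0 ≤ r) (hr1 : r < 1) :
    ∃ b : ℕ → ℝ, Tendsto b atTop (nhds 0) ∧ (∀ m, 0 ≤ b m) ∧
      ∃ m₀, ∀ m ≥ m₀, ∀ q : ℝ, |q| ≤ r → q ≠ 0 →
        Sfun (m + 2) q ≠ 0 ∧ |2 * q ^ m * yfun (m + 2) q - 1| ≤ b m := by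
  obtain ⟨M, hM⟩ := exists_abs_Cfun_le hr hr1
  have hM0 : 0 ≤ M := (abs_nonneg _).trans (hM 0 (by simpa using hr) 0)
  have htail := tendsto_chooseTail hr hr1
  have hpow := tendsto_pow_atTop_nhds_zero_of_lt_one hr hr1
  let e : ℕ → ℝ := fun n => M * (r ^ n + chooseTail r n)
  have he : Tendsto e atTop (nhds 0) := by simpa using (hpow.add htail).const_mul M
  have he0 : ∀ n, 0 ≤ e n := fun n =>
    mul_nonneg hM0 (add_nonneg (pow_nonneg hr n) (chooseTail_nonneg hr n))
  let t : ℕ → ℝ := fun n => 2 * e n + M ^ 2 * chooseTail r n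
  have ht : Tendsto t atTop (nhds 0) := by
    simpa using (he.const_mul 2).add (htail.const_mul (M ^ 2))
  have ht0 : ∀ n, 0 ≤ t n := fun n =>
    add_nonneg (mul_nonneg zero_le_two (he0 n))
      (mul_nonneg (sq_nonneg M) (chooseTail_nonneg hr n))
  refine ⟨fun m => 2 * e (m + 1) + t m + 2 * r ^ (m + 1), ?_, fun m => ?_, ?_⟩
  · simpa using (((he.comp (tendsto_add_atTop_nat 1)).const_mul 2).add ht).add
      ((hpow.comp (tendsto_add_atTop_nat 1)).const_mul 2)
  · exact add_nonneg (add_nonneg (mul_nonneg zero_le_two (he0 _)) (ht0 m)) (by positivity)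
  obtain ⟨m₀, hm₀⟩ := eventually_atTop.1
    ((ht.eventually_le_const one_pos).and (eventually_gt_atTop 0))
  refine ⟨m₀, fun m hm q hq hq0 => ?_⟩
  obtain ⟨htm, hmpos⟩ := hm₀ m hm
  have hC : ∀ n, |Cfun (n + 1) q - 1| ≤ e n := fun n =>
    abs_Cfun_sub_one_le hr1.le hq n (fun k _ => hM q hq k) hM0
  have hC1 := abs_le.1 (hC m)
  have hC2 := abs_le.1 (hC (m + 1))
  have hT := abs_le.1 (abs_splitFactor_sub_le (hM q hq) hq hmpos)
  have htdef : t m = 2 * e m + M ^ 2 * chooseTail r m := rfl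
  have hTge : 1 ≤ splitFactor m q := by linarith
  have hTne : splitFactor m q ≠ 0 := by positivity
  refine ⟨?_, ?_⟩
  · rw [Sfun_eq_splitFactor m hq0]
    exact mul_ne_zero (pow_ne_zero m hq0) hTne
  · have hquot : |2 * Cfun (m + 2) q / splitFactor m q - 1| ≤ 2 * e (m + 1) + t m := by
      rw [div_sub_one hTne, abs_div, abs_of_pos (zero_lt_one.trans_le hTge)]
      refine (div_le_self (abs_nonneg _) hTge).trans (abs_le.2 ⟨?_, ?_⟩) <;> linarith
    have hqpow : |2 * q ^ (m + 1)| ≤ 2 * r ^ (m + 1) := by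
      rw [abs_mul, abs_pow, abs_two]
      gcongr
    rw [yfun_eq m hq0 hTne, add_sub_right_comm]
    exact (abs_add_le _ _).trans (add_le_add hquot hqpow)

open Filter in
/-- On a compact `K ⊂ (-1, 0)`, the split reliability `S_n` is eventually nonvanishing on `K`
and `2 q^{n-2} ŷ_n(q) → 1` uniformly on `K`. -/
theorem yfun_asymptotics (K : Set ℝ) (hKc : IsCompact K) (hK : K ⊆ Set.Ioo (-1 : ℝ) 0) :
    ∃ N₀ : ℕ, (∀ n : ℕ, N₀ ≤ n → ∀ q ∈ K, Sfun n q ≠ 0) ∧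
      Tendsto (fun n : ℕ => ⨆ q ∈ K, |2 * q ^ (n - 2) * yfun n q - 1|) atTop (nhds 0) := by
  obtain ⟨r, hr, hr1, hKr⟩ : ∃ r : ℝ, 0 ≤ r ∧ r < 1 ∧ ∀ q ∈ K, |q| ≤ r := by
    rcases K.eq_empty_or_nonempty with rfl | hne
    · exact ⟨0, le_rfl, one_pos, fun q hq => absurd hq (Set.notMem_empty q)⟩
    · obtain ⟨q₀, hq₀, hmax⟩ := hKc.exists_isMaxOn hne continuous_abs.continuousOn
      refine ⟨|q₀|, abs_nonneg _, abs_lt.2 ⟨(hK hq₀).1, (hK hq₀).2.trans one_pos⟩, ?_⟩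
      exact fun q hq => hmax hq
  obtain ⟨b, hb, hb0, m₀, hm₀⟩ := exists_bound_yfun hr hr1
  refine ⟨m₀ + 2, fun n hn q hq => ?_, ?_⟩
  · obtain ⟨m, rfl⟩ := Nat.exists_eq_add_of_le' ((Nat.le_add_left 2 m₀).trans hn)
    exact (hm₀ m (by omega) q (hKr q hq) (hK hq).2.ne).1
  · rw [← tendsto_add_atTop_iff_nat 2]
    refine squeeze_zero' (Eventually.of_forall fun m => ?_) ?_ hb
    · exact Real.iSup_nonneg fun q => Real.iSup_nonneg fun _ => abs_nonneg _
    · filter_upwards [eventually_ge_atTop m₀] with m hm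
      refine Real.iSup_le (fun q => Real.iSup_le (fun hq => ?_) (hb0 m)) (hb0 m)
      exact (hm₀ m hm q (hKr q hq) (hK hq).2.ne).2

end
end

section
/- For every real number q with q ≠ 1 and 2q^3(12q^3 + 9q^2 + 3q + 1) ≠ 0, the virtual edge interaction of H_5 satisfies ŷ_5(q) = (1+q)(6q^5 + 6q^4 + 6q^3 + 4q^2 + 2q + 1) / (2q^3(12q^3 + 9q^2 + 3q + 1)). -/
open SimpleGraph Finset

noncomputable section

/-- Summing a function of the cardinality over the subsets of `t` that satisfy `P`. -/
theorem sum_powerset_ite_card {α : Type} (t : Finset α) (P : Finset α → Prop)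
    [DecidablePred P] (w : ℕ → ℝ) :
    (∑ A ∈ t.powerset, if P A then w A.card else 0) =
      ∑ k ∈ range (t.card + 1), (#{A ∈ powersetCard k t | P A} : ℝ) * w k := by
  rw [sum_powerset]
  refine sum_congr rfl fun k _ => ?_
  rw [← sum_filter, ← nsmul_eq_mul]
  refine sum_eq_card_nsmul fun A hA => ?_
  rw [(mem_powersetCard.1 (mem_filter.1 hA).1).2]

/-- `S` is a union of connected components of the graph with edges `A`. -/
def NoCrossing {V ι : Type} (a b : ι → V) (A : Finset ι) (S : Finset V) : Prop :=
  ∀ i ∈ A, (a i ∈ S ↔ b i ∈ S)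

instance {V ι : Type} [DecidableEq V] (a b : ι → V) (A : Finset ι) (S : Finset V) :
    Decidable (NoCrossing a b A S) :=
  inferInstanceAs (Decidable (∀ i ∈ A, (a i ∈ S ↔ b i ∈ S)))

section Cuts

variable {V ι : Type} {a b : ι → V} {A : Finset ι} {G : SimpleGraph V} {S : Finset V}

theorem NoCrossing.mem_of_reachable (hG : ∀ x y, G.Adj x y → ∃ i ∈ A, s(a i, b i) = s(x, y))
    (hS : NoCrossing a b A S) {x y : V} (h : G.Reachable x y) (hx : x ∈ S) : y ∈ S := by
  obtain ⟨p⟩ := h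
  induction p with
  | nil => exact hx
  | cons hadj _ ih =>
    refine ih ?_
    obtain ⟨i, hi, he⟩ := hG _ _ hadj
    have := hS i hi
    rcases Sym2.eq_iff.1 he with ⟨h1, h2⟩ | ⟨h1, h2⟩ <;> rw [h1, h2] at this <;> tauto

theorem noCrossing_of_forall_adj (hA : ∀ i ∈ A, G.Adj (a i) (b i))
    (hS : ∀ x y, G.Adj x y → x ∈ S → y ∈ S) : NoCrossing a b A S :=
  fun i hi => ⟨hS _ _ (hA i hi), hS _ _ (hA i hi).symm⟩

variable [Fintype V]

theorem connected_iff_noCrossing (hG : ∀ x y, G.Adj x y → ∃ i ∈ A, s(a i, b i) = s(x, y))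
    (hA : ∀ i ∈ A, G.Adj (a i) (b i)) (u : V) :
    G.Connected ↔ ∀ S, u ∈ S → NoCrossing a b A S → S = univ := by
  classical
  refine ⟨fun h S hu hS => eq_univ_of_forall fun w => hS.mem_of_reachable hG (h u w) hu,
    fun h => ?_⟩
  have key := h (univ.filter (G.Reachable u)) (by simp)
    (noCrossing_of_forall_adj hA fun x y hxy hx => by
      simp only [mem_filter, mem_univ, true_and] at hx ⊢
      exact hx.trans hxy.reachable)
  have hu : ∀ w, G.Reachable u w := fun w => by
    simpa using key.ge (mem_univ w)
  exact (SimpleGraph.connected_iff _).2 ⟨fun x y => (hu x).symm.trans (hu y), ⟨u⟩⟩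

theorem split_iff_noCrossing (hG : ∀ x y, G.Adj x y → ∃ i ∈ A, s(a i, b i) = s(x, y))
    (hA : ∀ i ∈ A, G.Adj (a i) (b i)) (u v : V) :
    (¬ G.Reachable u v ∧ ∀ w, G.Reachable u w ∨ G.Reachable v w) ↔
      (∀ S, u ∈ S → v ∈ S → NoCrossing a b A S → S = univ) ∧
        ∃ S, u ∈ S ∧ v ∉ S ∧ NoCrossing a b A S := by
  classical
  constructor
  · rintro ⟨huv, h⟩
    refine ⟨fun S hu hv hS => eq_univ_of_forall fun w => ?_,
      univ.filter (G.Reachable u), by simp, by simpa using huv,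
      noCrossing_of_forall_adj hA fun x y hxy hx => ?_⟩
    · rcases h w with h | h
      exacts [hS.mem_of_reachable hG h hu, hS.mem_of_reachable hG h hv]
    · simp only [mem_filter, mem_univ, true_and] at hx ⊢
      exact hx.trans hxy.reachable
  · rintro ⟨h, S, hu, hv, hS⟩
    refine ⟨fun huv => hv (hS.mem_of_reachable hG huv hu), fun w => ?_⟩
    have key := h (univ.filter fun w => G.Reachable u w ∨ G.Reachable v w) (by simp) (by simp)
      (noCrossing_of_forall_adj hA fun x y hxy hx => by
        simp only [mem_filter, mem_univ, true_and] at hx ⊢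
        exact hx.imp (·.trans hxy.reachable) (·.trans hxy.reachable))
    simpa using key.ge (mem_univ w)

end Cuts

/-- First endpoints of the nine edges of `Hgraph 5`. -/
def fstEnd : Fin 9 → Fin 5 := ![0, 0, 0, 1, 1, 1, 2, 2, 3]

/-- Second endpoints of the nine edges of `Hgraph 5`. -/
def sndEnd : Fin 9 → Fin 5 := ![2, 3, 4, 2, 3, 4, 3, 4, 4]

/-- The edges of `Hgraph 5`, enumerated. -/
def edgeEmb : Fin 9 ↪ Sym2 (Fin 5) := ⟨fun i => s(fstEnd i, sndEnd i), by decide⟩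

theorem edgeFin_Hgraph_five : edgeFin (Hgraph 5) = univ.map edgeEmb := by
  ext e
  have h : e ∈ edgeFin (Hgraph 5) ↔ ¬ e.IsDiag ∧ e ≠ s(0, 1) := by
    simp [edgeFin, Hgraph, SimpleGraph.edgeSet_deleteEdges]
  rw [h]
  clear h
  revert e
  decide +kernel

theorem fromEdgeSet_adj_iff (A : Finset (Fin 9)) (x y : Fin 5) :
    (SimpleGraph.fromEdgeSet (A.map edgeEmb : Set (Sym2 (Fin 5)))).Adj x y ↔
      ∃ i ∈ A, s(fstEnd i, sndEnd i) = s(x, y) := by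
  have hne : ∀ i, fstEnd i ≠ sndEnd i := by decide
  rw [SimpleGraph.fromEdgeSet_adj, Finset.mem_coe, Finset.mem_map]
  refine ⟨fun h => h.1, fun h => ⟨h, ?_⟩⟩
  rintro rfl
  obtain ⟨i, -, hi⟩ := h
  refine hne i ?_
  rcases Sym2.eq_iff.1 hi with ⟨h1, h2⟩ | ⟨h1, h2⟩ <;> rw [h1, h2]

theorem card_connected (k : Fin 10) :
    #{A ∈ powersetCard k (univ : Finset (Fin 9)) |
      ∀ S, (0 : Fin 5) ∈ S → NoCrossing fstEnd sndEnd A S → S = univ} =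
      (![0, 0, 0, 0, 75, 111, 82, 36, 9, 1] : Fin 10 → ℕ) k := by
  revert k
  decide +kernel

theorem card_split (k : Fin 10) :
    #{A ∈ powersetCard k (univ : Finset (Fin 9)) |
      (∀ S, (0 : Fin 5) ∈ S → 1 ∈ S → NoCrossing fstEnd sndEnd A S → S = univ) ∧
        ∃ S, (0 : Fin 5) ∈ S ∧ 1 ∉ S ∧ NoCrossing fstEnd sndEnd A S} =
      (![0, 0, 0, 50, 36, 12, 2, 0, 0, 0] : Fin 10 → ℕ) k := by
  revert k
  decide +kernel

theorem sum_edgeFin_Hgraph_five (w : ℕ → ℝ) (P : Finset (Sym2 (Fin 5)) → Prop)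
    {_ : DecidablePred P} (Q : Finset (Fin 9) → Prop) [DecidablePred Q]
    (hPQ : ∀ A, P (A.map edgeEmb) ↔ Q A) (N : Fin 10 → ℕ)
    (hN : ∀ k : Fin 10, #{A ∈ powersetCard k (univ : Finset (Fin 9)) | Q A} = N k) :
    (∑ A ∈ (edgeFin (Hgraph 5)).powerset, if P A then w A.card else 0) =
      ∑ k, (N k : ℝ) * w k := by
  have hsum : (∑ A ∈ (univ.map edgeEmb).powerset, if P A then w A.card else 0) =
      ∑ A ∈ (univ : Finset (Fin 9)).powerset, if Q A then w A.card else 0 := by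
    symm
    refine sum_bij (fun A _ => A.map edgeEmb) (fun A _ => ?_)
      (fun A _ B _ h => map_injective _ h) (fun B hB => ?_) (fun A _ => ?_)
    · simp
    · obtain ⟨A, hA, rfl⟩ := subset_map_iff.1 (mem_powerset.1 hB)
      exact ⟨A, mem_powerset.2 hA, rfl⟩
    · simp only [hPQ, card_map]
  rw [edgeFin_Hgraph_five, hsum, sum_powerset_ite_card, card_univ, Fintype.card_fin, sum_range]
  simp only [hN]

theorem Rfun_five (q : ℝ) :
    Rfun 5 q = (1 - q) ^ 4 * (75 * q ^ 5 + 111 * (1 - q) * q ^ 4 + 82 * (1 - q) ^ 2 * q ^ 3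
      + 36 * (1 - q) ^ 3 * q ^ 2 + 9 * (1 - q) ^ 4 * q + (1 - q) ^ 5) := by
  have hE : #(edgeFin (Hgraph 5)) = 9 := by simp [edgeFin_Hgraph_five]
  rw [Rfun, relPoly, hE]
  refine (sum_edgeFin_Hgraph_five (fun k => (1 - q) ^ k * q ^ (9 - k)) _ _
    (fun A => connected_iff_noCrossing (fun x y => (fromEdgeSet_adj_iff A x y).1)
      (fun i hi => (fromEdgeSet_adj_iff A _ _).2 ⟨i, hi, rfl⟩) 0) _ card_connected).trans ?_
  simp [Fin.sum_univ_succ]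
  ring

theorem Sfun_five (q : ℝ) :
    Sfun 5 q = (1 - q) ^ 3 * (2 * q ^ 3 * (12 * q ^ 3 + 9 * q ^ 2 + 3 * q + 1)) := by
  have hE : #(edgeFin (Hgraph 5)) = 9 := by simp [edgeFin_Hgraph_five]
  rw [Sfun, dif_pos (by norm_num), splitRel, hE]
  refine (sum_edgeFin_Hgraph_five (fun k => (1 - q) ^ k * q ^ (9 - k)) _ _
    (fun A => split_iff_noCrossing (fun x y => (fromEdgeSet_adj_iff A x y).1)
      (fun i hi => (fromEdgeSet_adj_iff A _ _).2 ⟨i, hi, rfl⟩) 0 1) _ card_split).trans ?_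
  simp [Fin.sum_univ_succ]
  ring

/-- Explicit formula for the virtual edge interaction of `H_5 = K_5` minus an edge. -/
theorem yhat_H5 (q : ℝ) (h1 : q ≠ 1)
    (h2 : 2 * q ^ 3 * (12 * q ^ 3 + 9 * q ^ 2 + 3 * q + 1) ≠ 0) :
    yfun 5 q = (1 + q) * (6 * q ^ 5 + 6 * q ^ 4 + 6 * q ^ 3 + 4 * q ^ 2 + 2 * q + 1)
      / (2 * q ^ 3 * (12 * q ^ 3 + 9 * q ^ 2 + 3 * q + 1)) := by
  have h3 : (1 - q) ^ 3 ≠ 0 := pow_ne_zero _ (sub_ne_zero.2 h1.symm)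
  rw [yfun, Rfun_five, Sfun_five, div_add_one (mul_ne_zero h3 h2),
    div_eq_div_iff (mul_ne_zero h3 h2) h2]
  ring

end
end
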